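/- Let λ* = λ*(q,p) be the bifurcation value of the family x' = −x² + q(t)x + p(t) + λ. If λ* ≤ λ₁ < λ₂, then B_{λ₁} ⊊ B_{λ₂}; more precisely, r_{λ₂}(t) < r_{λ₁}(t) ≤ a_{λ₁}(t) < a_{λ₂}(t) for all t ∈ ℝ. In addition, a_λ(t) → ∞ and r_λ(t) → −∞ as λ → ∞, uniformly in t ∈ ℝ. -/

import Mathlib

open Set Filter

/-- The right-hand side of the quadratic equation `x' = -x² + Q(t)x + P(t)`. -/
def quadF (Q P : ℝ → ℝ) : ℝ → ℝ → ℝ := fun t x => -x ^ 2 + Q t * x + P t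

/-- `b` is a globally defined bounded solution of `x' = -x² + Q(t)x + P(t)`. -/
def IsBddSol (Q P b : ℝ → ℝ) : Prop :=
  (∀ t, HasDerivAt b (quadF Q P t (b t)) t) ∧ ∃ C, ∀ t, |b t| ≤ C

/-- `(k, β)` is a dichotomy constant pair witnessing that the variational equation
`z' = (-2 b(t) + Q(t)) z` is Hurwitz at `+∞` (attractive case). -/
def AttrDich (Q b : ℝ → ℝ) (k β : ℝ) : Prop :=
  1 ≤ k ∧ 0 < β ∧ ∀ s t : ℝ, s ≤ t →
    Real.exp (∫ l in s..t, (-2 * b l + Q l)) ≤ k * Real.exp (-β * (t - s))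

/-- `(k, β)` is a dichotomy constant pair witnessing that the variational equation
`z' = (-2 b(t) + Q(t)) z` is Hurwitz at `−∞` (repulsive case). -/
def RepDich (Q b : ℝ → ℝ) (k β : ℝ) : Prop :=
  1 ≤ k ∧ 0 < β ∧ ∀ s t : ℝ, t ≤ s →
    Real.exp (∫ l in s..t, (-2 * b l + Q l)) ≤ k * Real.exp (β * (t - s))

/-- `b` is an attractive hyperbolic solution of `x' = -x² + Q(t)x + P(t)`. -/
def IsAttrHyp (Q P b : ℝ → ℝ) : Prop := IsBddSol Q P b ∧ ∃ k β : ℝ, AttrDich Q b k β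

/-- `b` is a repulsive hyperbolic solution of `x' = -x² + Q(t)x + P(t)`. -/
def IsRepHyp (Q P b : ℝ → ℝ) : Prop := IsBddSol Q P b ∧ ∃ k β : ℝ, RepDich Q b k β

/-- `b` is a hyperbolic solution of `x' = -x² + Q(t)x + P(t)`. -/
def IsHyp (Q P b : ℝ → ℝ) : Prop := IsAttrHyp Q P b ∨ IsRepHyp Q P b

/-- The supremum norm distance between `f` and `g` is `< δ`. -/
def SupLt (f g : ℝ → ℝ) (δ : ℝ) : Prop := ∃ d : ℝ, d < δ ∧ ∀ t, |f t - g t| ≤ d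

/-- The family of maximal solutions `t ↦ X t s x₀` of the scalar ODE `x' = h (t, x)`. -/
structure MaxSolFamily (h : ℝ → ℝ → ℝ) where
  X : ℝ → ℝ → ℝ → ℝ
  dom : ℝ → ℝ → Set ℝ
  dom_open : ∀ s x₀, IsOpen (dom s x₀)
  dom_ordConn : ∀ s x₀, (dom s x₀).OrdConnected
  mem_dom : ∀ s x₀, s ∈ dom s x₀
  init : ∀ s x₀, X s s x₀ = x₀
  sol : ∀ s x₀, ∀ t ∈ dom s x₀, HasDerivAt (fun τ => X τ s x₀) (h t (X t s x₀)) t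
  maximal : ∀ s x₀ (y : ℝ → ℝ) (I : Set ℝ), IsOpen I → I.OrdConnected → s ∈ I →
      y s = x₀ → (∀ t ∈ I, HasDerivAt y (h t (y t)) t) →
      I ⊆ dom s x₀ ∧ ∀ t ∈ I, y t = X t s x₀

/-- The solution `X · s x₀` is (defined and) bounded as `t → −∞`. -/
def BddAtBot {h : ℝ → ℝ → ℝ} (F : MaxSolFamily h) (s x₀ : ℝ) : Prop :=
  ∃ C : ℝ, ∀ᶠ t in atBot, t ∈ F.dom s x₀ ∧ |F.X t s x₀| ≤ C

/-- The solution `X · s x₀` is (defined and) bounded as `t → ∞`. -/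
def BddAtTop {h : ℝ → ℝ → ℝ} (F : MaxSolFamily h) (s x₀ : ℝ) : Prop :=
  ∃ C : ℝ, ∀ᶠ t in atTop, t ∈ F.dom s x₀ ∧ |F.X t s x₀| ≤ C

/-- `a` is the globally defined bounded solution characterized by:
`X · s x₀` is bounded as `t → −∞` iff `x₀ ≤ a s`. -/
def CharA {h : ℝ → ℝ → ℝ} (F : MaxSolFamily h) (a : ℝ → ℝ) : Prop :=
  (∀ t, HasDerivAt a (h t (a t)) t) ∧ (∃ C, ∀ t, |a t| ≤ C) ∧
  ∀ s x₀ : ℝ, BddAtBot F s x₀ ↔ x₀ ≤ a s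

/-- `r` is the globally defined bounded solution characterized by:
`X · s x₀` is bounded as `t → ∞` iff `x₀ ≥ r s`. -/
def CharR {h : ℝ → ℝ → ℝ} (F : MaxSolFamily h) (r : ℝ → ℝ) : Prop :=
  (∀ t, HasDerivAt r (h t (r t)) t) ∧ (∃ C, ∀ t, |r t| ≤ C) ∧
  ∀ s x₀ : ℝ, BddAtTop F s x₀ ↔ r s ≤ x₀

/-- The set of initial pairs giving rise to globally defined bounded solutions. -/
def GlobBdd {h : ℝ → ℝ → ℝ} (F : MaxSolFamily h) : Set (ℝ × ℝ) :=
  {sx | (∀ t : ℝ, t ∈ F.dom sx.1 sx.2) ∧ ∃ C, ∀ t : ℝ, |F.X t sx.1 sx.2| ≤ C}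

/-- The time-and-space reflection `t ↦ -x(-t)` of a family of maximal solutions. -/
def MaxSolFamily.reflect {h : ℝ → ℝ → ℝ} (F : MaxSolFamily h) :
    MaxSolFamily (fun t x => h (-t) (-x)) where
  X t s x := -F.X (-t) (-s) (-x)
  dom s x := {t | -t ∈ F.dom (-s) (-x)}
  dom_open s x := (F.dom_open (-s) (-x)).preimage continuous_neg
  dom_ordConn s x := by
    refine ⟨fun a ha b hb c hc => ?_⟩
    exact (F.dom_ordConn (-s) (-x)).out hb ha ⟨neg_le_neg hc.2, neg_le_neg hc.1⟩
  mem_dom s x := F.mem_dom (-s) (-x)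
  init s x := by simp [F.init]
  sol s x t ht := by
    have h1 := F.sol (-s) (-x) (-t) ht
    have h2 := (h1.comp t (hasDerivAt_neg t)).neg
    simpa [Function.comp_def, Pi.neg_def] using h2
  maximal s x y I hI hc hs hy hd := by
    have key := F.maximal (-s) (-x) (fun t => -y (-t)) {t | -t ∈ I}
      (hI.preimage continuous_neg)
      ⟨fun a ha b hb c hc' => hc.out hb ha ⟨neg_le_neg hc'.2, neg_le_neg hc'.1⟩⟩
      (by simpa using hs) (by simp [hy]) (fun t ht => by
        have h2 := ((hd (-t) ht).comp t (hasDerivAt_neg t)).neg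
        simpa [Function.comp_def, Pi.neg_def] using h2)
    refine ⟨fun t ht => key.1 (by simpa using ht), fun t ht => ?_⟩
    have := key.2 (-t) (by simpa using ht)
    simp only [neg_neg] at this
    linarith

/-- A global solution through `(s, b s)` coincides with the maximal solution. -/
lemma MaxSolFamily.eq_of_global {h : ℝ → ℝ → ℝ} (F : MaxSolFamily h) {b : ℝ → ℝ}
    (hb : ∀ t, HasDerivAt b (h t (b t)) t) (s t : ℝ) :
    t ∈ F.dom s (b s) ∧ F.X t s (b s) = b t := by
  obtain ⟨h1, h2⟩ := F.maximal s (b s) b univ isOpen_univ ordConnected_univ (mem_univ s) rfl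
    (fun t _ => hb t)
  exact ⟨h1 (mem_univ t), (h2 t (mem_univ t)).symm⟩

/-- A function starting below another one stays below it, if it grows strictly slower wherever
the two meet. -/
lemma le_of_hasDerivAt_lt {f g f' g' : ℝ → ℝ} {s T : ℝ} (hsT : s ≤ T)
    (hf : ∀ t ∈ Icc s T, HasDerivAt f (f' t) t) (hg : ∀ t ∈ Icc s T, HasDerivAt g (g' t) t)
    (h0 : f s ≤ g s) (hlt : ∀ t ∈ Icc s T, f t = g t → f' t < g' t) : f T ≤ g T :=
  image_le_of_deriv_right_lt_deriv_boundary'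
    (fun t ht => (hf t ht).continuousAt.continuousWithinAt)
    (fun t ht => (hf t (Ico_subset_Icc_self ht)).hasDerivWithinAt) h0
    (fun t ht => (hg t ht).continuousAt.continuousWithinAt)
    (fun t ht => (hg t (Ico_subset_Icc_self ht)).hasDerivWithinAt)
    (fun t ht => hlt t (Ico_subset_Icc_self ht)) (right_mem_Icc.2 hsT)

/-- A maximal solution along which the vector field stays bounded is defined for all
future times. -/
lemma MaxSolFamily.mem_dom_of_bounded {h : ℝ → ℝ → ℝ} (hc : Continuous (Function.uncurry h))
    (F : MaxSolFamily h) {s x₀ L : ℝ}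
    (hL : ∀ t ∈ F.dom s x₀, s ≤ t → |h t (F.X t s x₀)| ≤ L) {T : ℝ} (hT : s ≤ T) :
    T ∈ F.dom s x₀ := by
  by_contra hTd
  set A : Set ℝ := Ici s ∩ (F.dom s x₀)ᶜ with hA
  have hAc : IsClosed A := isClosed_Ici.inter (F.dom_open s x₀).isClosed_compl
  have hAb : BddBelow A := ⟨s, fun t ht => ht.1⟩
  have hmem : sInf A ∈ A := hAc.csInf_mem ⟨T, hT, hTd⟩ hAb
  set e := sInf A with he
  have hse : s < e := lt_of_le_of_ne hmem.1 (fun h => hmem.2 (h ▸ F.mem_dom s x₀))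
  have hdom : Ico s e ⊆ F.dom s x₀ := by
    intro t ht
    by_contra htd
    exact absurd (csInf_le hAb ⟨ht.1, htd⟩) (not_le.2 ht.2)
  have hLip : LipschitzOnWith L.toNNReal (fun t => F.X t s x₀) (Ico s e) := by
    refine (convex_Ico s e).lipschitzOnWith_of_nnnorm_hasDerivWithin_le
      (fun t ht => (F.sol s x₀ t (hdom ht)).hasDerivWithinAt) (fun t ht => ?_)
    rw [← NNReal.coe_le_coe, coe_nnnorm, Real.norm_eq_abs]
    exact (hL t (hdom ht) ht.1).trans (Real.le_coe_toNNReal L)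
  obtain ⟨g, hg, hgeq⟩ := hLip.extend_real
  have hgc : Continuous g := hg.continuous
  obtain ⟨ε, hε, hεd⟩ := Metric.isOpen_iff.1 (F.dom_open s x₀) s (F.mem_dom s x₀)
  obtain ⟨η, hη, hηd⟩ := Metric.isOpen_iff.1 (F.dom_open e (g e)) e (F.mem_dom e (g e))
  rw [Real.ball_eq_Ioo] at hεd hηd
  set y : ℝ → ℝ := fun t => if t < e then F.X t s x₀ else F.X t e (g e) with hy
  have hyl : ∀ t, t < e → y t = F.X t s x₀ := fun t ht => if_pos ht
  have hyr : ∀ t, e ≤ t → y t = F.X t e (g e) := fun t ht => if_neg (not_lt.2 ht)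
  have hye : y e = g e := by rw [hyr e le_rfl, F.init]
  have hleft : ∀ t ∈ Ioo (s - ε) e, HasDerivAt y (h t (y t)) t := by
    intro t ht
    have htd : t ∈ F.dom s x₀ := by
      rcases lt_or_ge t s with hts | hts
      · exact hεd ⟨ht.1, by linarith⟩
      · exact hdom ⟨hts, ht.2⟩
    rw [hyl t ht.2]
    refine (F.sol s x₀ t htd).congr_of_eventuallyEq ?_
    filter_upwards [Iio_mem_nhds ht.2] with τ hτ using hyl τ hτ
  have hIoo : Ioo s e ∈ nhdsWithin e (Iio e) := Ioo_mem_nhdsLT hse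
  have hyg : y =ᶠ[nhdsWithin e (Iio e)] g := by
    filter_upwards [hIoo] with t ht
    rw [hyl t ht.2, ← hgeq ⟨ht.1.le, ht.2⟩]
  have hylim : Tendsto y (nhdsWithin e (Iio e)) (nhds (g e)) :=
    (hgc.continuousAt.tendsto.mono_left nhdsWithin_le_nhds).congr' hyg.symm
  have hat : HasDerivAt y (h e (y e)) e := by
    have h1 : HasDerivWithinAt y (h e (y e)) (Iic e) e := by
      refine hasDerivWithinAt_Iic_of_tendsto_deriv (s := Ioo s e) (fun t ht =>
        (hleft t ⟨by linarith [ht.1], ht.2⟩).differentiableAt.differentiableWithinAt)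
        ?_ hIoo ?_
      · rw [ContinuousWithinAt, hye]
        exact hylim.mono_left (nhdsWithin_mono e fun t ht => ht.2)
      · have h2 : Tendsto (fun t => h t (y t)) (nhdsWithin e (Iio e)) (nhds (h e (y e))) := by
          rw [hye]
          exact (hc.tendsto (e, g e)).comp
            ((tendsto_id.mono_left nhdsWithin_le_nhds).prodMk_nhds hylim)
        refine h2.congr' ?_
        filter_upwards [hIoo] with t ht
        exact (hleft t ⟨by linarith [ht.1], ht.2⟩).deriv.symm
    have h2 : HasDerivWithinAt y (h e (y e)) (Ici e) e := by
      rw [hyr e le_rfl]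
      exact (F.sol e (g e) e (F.mem_dom e (g e))).hasDerivWithinAt.congr
        (fun t ht => hyr t ht) (hyr e le_rfl)
    have h3 := h1.union h2
    rwa [Iic_union_Ici, hasDerivWithinAt_univ] at h3
  have hright : ∀ t ∈ Ioo e (e + η), HasDerivAt y (h t (y t)) t := by
    intro t ht
    rw [hyr t ht.1.le]
    refine (F.sol e (g e) t (hηd ⟨by linarith [ht.1], ht.2⟩)).congr_of_eventuallyEq ?_
    filter_upwards [Ioi_mem_nhds ht.1] with τ hτ using hyr τ (le_of_lt hτ)
  refine hmem.2 ((F.maximal s x₀ y (Ioo (s - ε) (e + η)) isOpen_Ioo ordConnected_Ioo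
    ⟨by linarith, by linarith⟩ (by rw [hyl s hse, F.init]) ?_).1 ⟨by linarith, by linarith⟩)
  intro t ht
  rcases lt_trichotomy t e with hte | hte | hte
  · exact hleft t ⟨ht.1, hte⟩
  · exact hte ▸ hat
  · exact hright t ⟨hte, ht.2⟩

lemma abs_quadF_le {q P : ℝ → ℝ} {Q R C t x : ℝ} (hq : |q t| ≤ Q) (hP : |P t| ≤ R)
    (hx : |x| ≤ C) : |quadF q P t x| ≤ C ^ 2 + Q * C + R := by
  have h1 : |x ^ 2| ≤ C ^ 2 := by rw [abs_pow]; gcongr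
  have h2 : |q t * x| ≤ Q * C := by
    rw [abs_mul]; exact mul_le_mul hq hx (abs_nonneg _) ((abs_nonneg _).trans hq)
  rw [abs_le] at *
  unfold quadF
  constructor <;> linarith [h1.1, h1.2, h2.1, h2.2, hP.1, hP.2]

lemma quadF_le_neg_one {q P : ℝ → ℝ} {Q R t x : ℝ} (hq : |q t| ≤ Q) (hP : |P t| ≤ R)
    (hx : Q + R + 1 ≤ x) : quadF q P t x ≤ -1 := by
  have hQ := (abs_nonneg _).trans hq
  have hR := (abs_nonneg _).trans hP
  have h1 := (abs_le.1 hq).2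
  have h2 := (abs_le.1 hP).2
  unfold quadF
  nlinarith [mul_le_mul_of_nonneg_right h1 (by linarith : (0:ℝ) ≤ x),
    mul_le_mul_of_nonneg_right hx (by linarith : (0:ℝ) ≤ x), mul_nonneg hR (by linarith : 0 ≤ x - 1)]

/-- A solution starting above a bounded strict subsolution is defined for all future times, and
it remains between that subsolution and a constant. -/
lemma forward_of_subsolution {q P : ℝ → ℝ} (hqc : Continuous q) (hPc : Continuous P) {Q R : ℝ}
    (hq : ∀ t, |q t| ≤ Q) (hP : ∀ t, |P t| ≤ R) (F : MaxSolFamily (quadF q P))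
    {w w' : ℝ → ℝ} (hw : ∀ t, HasDerivAt w (w' t) t) (hlt : ∀ t, w' t < quadF q P t (w t))
    {C : ℝ} (hC : ∀ t, -C ≤ w t) {s x₀ : ℝ} (h0 : w s ≤ x₀) {t : ℝ} (ht : s ≤ t) :
    t ∈ F.dom s x₀ ∧ w t ≤ F.X t s x₀ ∧ F.X t s x₀ ≤ max x₀ (Q + R + 1) := by
  have hbd : ∀ t ∈ F.dom s x₀, s ≤ t → w t ≤ F.X t s x₀ ∧ F.X t s x₀ ≤ max x₀ (Q + R + 1) := by
    intro T hT hsT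
    have hsub : Icc s T ⊆ F.dom s x₀ := (F.dom_ordConn s x₀).out (F.mem_dom s x₀) hT
    constructor
    · refine le_of_hasDerivAt_lt hsT (fun t _ => hw t) (fun t ht => F.sol s x₀ t (hsub ht))
        (by rwa [F.init]) (fun t _ h => ?_)
      rw [← h]
      exact hlt t
    · refine le_of_hasDerivAt_lt (f := fun t => F.X t s x₀)
        (g := fun _ => max x₀ (Q + R + 1)) (g' := fun _ => 0) hsT
        (fun t ht => F.sol s x₀ t (hsub ht)) (fun t _ => hasDerivAt_const _ _)
        (by rw [F.init]; exact le_max_left _ _) (fun t _ h => ?_)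
      rw [h]
      linarith [quadF_le_neg_one (hq t) (hP t) (le_max_right x₀ (Q + R + 1))]
  have hmem : t ∈ F.dom s x₀ := by
    have hcont : Continuous (Function.uncurry (quadF q P)) := by
      simp only [Function.uncurry_def, quadF]
      fun_prop
    refine F.mem_dom_of_bounded hcont (fun t ht hst => abs_quadF_le (hq t) (hP t)
      (C := max C (max x₀ (Q + R + 1))) ?_) ht
    obtain ⟨h1, h2⟩ := hbd t ht hst
    exact abs_le.2 ⟨by linarith [hC t, le_max_left C (max x₀ (Q + R + 1))],
      h2.trans (le_max_right _ _)⟩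
  exact ⟨hmem, hbd t hmem ht⟩

/-- A solution starting below a bounded strict subsolution is defined for all past times, and it
remains between a constant and that subsolution. -/
lemma backward_of_subsolution {q P : ℝ → ℝ} (hqc : Continuous q) (hPc : Continuous P) {Q R : ℝ}
    (hq : ∀ t, |q t| ≤ Q) (hP : ∀ t, |P t| ≤ R) (F : MaxSolFamily (quadF q P))
    {w w' : ℝ → ℝ} (hw : ∀ t, HasDerivAt w (w' t) t) (hlt : ∀ t, w' t < quadF q P t (w t))
    {C : ℝ} (hC : ∀ t, w t ≤ C) {s x₀ : ℝ} (h0 : x₀ ≤ w s) {t : ℝ} (ht : t ≤ s) :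
    t ∈ F.dom s x₀ ∧ F.X t s x₀ ≤ w t ∧ -max (-x₀) (Q + R + 1) ≤ F.X t s x₀ := by
  have hrefl : (fun t x => quadF q P (-t) (-x)) =
      quadF (fun t => -q (-t)) (fun t => P (-t)) := by
    funext t x
    simp [quadF]
  obtain ⟨G, hGX, hGd⟩ : ∃ G : MaxSolFamily (quadF (fun t => -q (-t)) (fun t => P (-t))),
      (∀ t s x, G.X t s x = -F.X (-t) (-s) (-x)) ∧
      ∀ t s x, t ∈ G.dom s x ↔ -t ∈ F.dom (-s) (-x) := by
    rw [← hrefl]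
    exact ⟨F.reflect, fun _ _ _ => rfl, fun _ _ _ => Iff.rfl⟩
  have key := forward_of_subsolution (q := fun t => -q (-t)) (P := fun t => P (-t))
    (by fun_prop) (by fun_prop) (Q := Q) (R := R) (fun t => by simpa using hq (-t))
    (fun t => hP (-t)) G (w := fun t => -w (-t)) (w' := fun t => w' (-t))
    (fun t => by simpa [Function.comp_def, Pi.neg_def] using ((hw (-t)).comp t (hasDerivAt_neg t)).neg)
    (fun t => by simpa [quadF] using hlt (-t)) (C := C) (fun t => neg_le_neg (hC (-t)))
    (s := -s) (x₀ := -x₀) (by simpa using h0) (neg_le_neg ht)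
  rw [hGX, hGd] at key
  simp only [neg_neg] at key
  exact ⟨key.1, by linarith [key.2.1], by linarith [key.2.2]⟩

/-- Bounded solutions admit an upper bound depending only on the bounds of the coefficients. -/
lemma IsBddSol.le {q P b : ℝ → ℝ} {Q R : ℝ} (hq : ∀ t, |q t| ≤ Q) (hP : ∀ t, |P t| ≤ R)
    (hb : IsBddSol q P b) (t : ℝ) : b t ≤ Q + R + 1 := by
  by_contra! hlt
  obtain ⟨hd, C, hC⟩ := hb
  have hC0 : 0 ≤ C := (abs_nonneg _).trans (hC t)
  have hQ := (abs_nonneg _).trans (hq t)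
  have hR := (abs_nonneg _).trans (hP t)
  have key := le_of_hasDerivAt_lt (f := fun τ => b t + τ / 2) (f' := fun _ => 1 / 2)
    (g := fun τ => b (t - τ)) (g' := fun τ => -quadF q P (t - τ) (b (t - τ)))
    (s := 0) (T := 2 * C) (by linarith)
    (fun τ _ => by simpa using ((hasDerivAt_id τ).div_const 2).const_add (b t))
    (fun τ _ => by
      simpa [Function.comp_def] using (hd (t - τ)).comp τ ((hasDerivAt_id τ).const_sub t))
    (by simp) (fun τ hτ h => by
      have := quadF_le_neg_one (x := b (t - τ)) (hq (t - τ)) (hP (t - τ))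
        (by rw [← h]; linarith [hτ.1])
      linarith)
  have h2 := (abs_le.1 (hC (t - 2 * C))).2
  linarith

/-- A solution starting on a bounded solution for a smaller parameter is global and bounded. -/
lemma global_of_bddSol_lt {q p b : ℝ → ℝ} (hqc : Continuous q) (hpc : Continuous p)
    {Q R : ℝ} (hq : ∀ t, |q t| ≤ Q) (hp : ∀ t, |p t| ≤ R) {l₁ l₂ : ℝ} (hl : l₁ < l₂)
    (F : MaxSolFamily (quadF q (fun t => p t + l₂)))
    (hb : IsBddSol q (fun t => p t + l₁) b) (s : ℝ) :
    (∀ t, t ∈ F.dom s (b s)) ∧ (∃ C, ∀ t, |F.X t s (b s)| ≤ C) ∧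
      ∀ t, s ≤ t → b t ≤ F.X t s (b s) := by
  obtain ⟨hd, C, hC⟩ := hb
  have hP : ∀ t, |p t + l₂| ≤ R + |l₂| := fun t =>
    (abs_add_le _ _).trans (add_le_add (hp t) le_rfl)
  have hlt : ∀ t, quadF q (fun t => p t + l₁) t (b t) < quadF q (fun t => p t + l₂) t (b t) :=
    fun t => by simp only [quadF]; linarith
  have hf := fun t (ht : s ≤ t) => forward_of_subsolution hqc (by fun_prop) hq hP F hd hlt
    (fun t => (abs_le.1 (hC t)).1) le_rfl ht
  have hk := fun t (ht : t ≤ s) => backward_of_subsolution hqc (by fun_prop) hq hP F hd hlt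
    (fun t => (abs_le.1 (hC t)).2) le_rfl ht
  refine ⟨fun t => ?_, ⟨max C (max (max (b s) (-b s)) (Q + (R + |l₂|) + 1)), fun t => ?_⟩,
    fun t ht => (hf t ht).2.1⟩
  · rcases le_total s t with h | h
    · exact (hf t h).1
    · exact (hk t h).1
  · have hb1 := (abs_le.1 (hC t)).1
    have hb2 := (abs_le.1 (hC t)).2
    rcases le_total s t with h | h
    · obtain ⟨-, h1, h2⟩ := hf t h
      grind
    · obtain ⟨-, h1, h2⟩ := hk t h
      grind

lemma IsBddSol.of_mem_globBdd {Q P : ℝ → ℝ} {F : MaxSolFamily (quadF Q P)} {s x : ℝ}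
    (h : (s, x) ∈ GlobBdd F) : IsBddSol Q P (fun t => F.X t s x) :=
  ⟨fun t => F.sol s x t (h.1 t), h.2⟩

lemma IsBddSol.mem_globBdd {Q P b : ℝ → ℝ} (hb : IsBddSol Q P b) (F : MaxSolFamily (quadF Q P))
    (s : ℝ) : (s, b s) ∈ GlobBdd F := by
  refine ⟨fun t => (F.eq_of_global hb.1 s t).1, hb.2.imp fun C hC t => ?_⟩
  simpa only [(F.eq_of_global hb.1 s t).2] using hC t

lemma globBdd_subset {q p : ℝ → ℝ} (hqc : Continuous q) (hpc : Continuous p)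
    {Q R : ℝ} (hq : ∀ t, |q t| ≤ Q) (hp : ∀ t, |p t| ≤ R) {l₁ l₂ : ℝ} (hl : l₁ < l₂)
    (F₁ : MaxSolFamily (quadF q (fun t => p t + l₁)))
    (F₂ : MaxSolFamily (quadF q (fun t => p t + l₂))) : GlobBdd F₁ ⊆ GlobBdd F₂ := by
  rintro ⟨s, x⟩ h
  have := global_of_bddSol_lt hqc hpc hq hp hl F₂ (IsBddSol.of_mem_globBdd h) s
  rw [F₁.init] at this
  exact ⟨this.1, this.2.1⟩

lemma globBdd_ssubset {q p : ℝ → ℝ} (hqc : Continuous q) (hpc : Continuous p)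
    {Q R : ℝ} (hq : ∀ t, |q t| ≤ Q) (hp : ∀ t, |p t| ≤ R) {l₁ l₂ : ℝ} (hl : l₁ < l₂)
    (F₁ : MaxSolFamily (quadF q (fun t => p t + l₁)))
    (F₂ : MaxSolFamily (quadF q (fun t => p t + l₂)))
    (hne : ∃ b, IsBddSol q (fun t => p t + l₁) b) : GlobBdd F₁ ⊂ GlobBdd F₂ := by
  refine ⟨globBdd_subset hqc hpc hq hp hl F₁ F₂, fun hsub => ?_⟩
  have hP : ∀ t, |p t + l₁| ≤ R + |l₁| := fun t =>
    (abs_add_le _ _).trans (add_le_add (hp t) le_rfl)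
  set M := Q + (R + |l₁|) + 1 with hM
  set S : Set ℝ := {x | (1, x) ∈ GlobBdd F₁} with hS
  have hSM : ∀ x ∈ S, x ≤ M := fun x hx => by
    simpa [F₁.init] using (IsBddSol.of_mem_globBdd hx).le hq hP 1
  have hSne : S.Nonempty := hne.imp' (fun b => b 1) fun b hb => hb.mem_globBdd F₁ 1
  have hQ := (abs_nonneg _).trans (hq 0)
  have hR := (abs_nonneg _).trans (hp 0)
  have hM1 : 1 ≤ M := by linarith [abs_nonneg l₁]
  set K := 2 * M + Q + 3 with hK
  have hK0 : 0 < K := by linarith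
  obtain ⟨δ, hδ0, hδ1, hδ⟩ : ∃ δ : ℝ, 0 < δ ∧ δ ≤ 1 ∧ δ * K ≤ l₂ - l₁ :=
    ⟨min 1 ((l₂ - l₁) / K), lt_min one_pos (div_pos (by linarith) hK0), min_le_left _ _,
      (le_div_iff₀ hK0).1 (min_le_right _ _)⟩
  obtain ⟨x, hxS, hx⟩ := exists_lt_of_lt_csSup hSne (sub_lt_self (sSup S) hδ0)
  set b := fun t => F₁.X t 1 x with hbdef
  have hb : IsBddSol q (fun t => p t + l₁) b := IsBddSol.of_mem_globBdd hxS
  have hb1 : b 1 = x := F₁.init 1 x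
  have hmem : (0, b 0) ∈ GlobBdd F₂ :=
    globBdd_subset hqc hpc hq hp hl F₁ F₂ (hb.mem_globBdd F₁ 0)
  have hu := IsBddSol.of_mem_globBdd hmem
  set u := fun t => F₂.X t 0 (b 0) with hudef
  have hgap : b 1 + δ * 1 ≤ u 1 := by
    refine le_of_hasDerivAt_lt (f := fun t => b t + δ * t)
      (f' := fun t => quadF q (fun t => p t + l₁) t (b t) + δ)
      zero_le_one (fun t _ => by
        simpa [Pi.add_def] using (hb.1 t).add ((hasDerivAt_id t).const_mul δ))
      (fun t _ => hu.1 t) (by simp [hudef, F₂.init]) (fun t ht h => ?_)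
    rw [← h]
    have hbM := hb.le hq hP t
    have hqt := abs_le.1 (hq t)
    have e1 : 0 ≤ δ * t := mul_nonneg hδ0.le ht.1
    have e2 : δ * t ≤ δ := mul_le_of_le_one_right hδ0.le ht.2
    have e3 : 2 * b t + δ * t - q t ≤ 2 * M + 1 + Q := by linarith
    have e4 : δ * t * (2 * b t + δ * t - q t) ≤ δ * (2 * M + 1 + Q) :=
      (mul_le_mul_of_nonneg_left e3 e1).trans
        (mul_le_mul_of_nonneg_right e2 (by linarith))
    simp only [quadF]
    nlinarith
  have hu1 : u 1 ∈ S := hsub (hu.mem_globBdd F₂ 1)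
  linarith [le_csSup ⟨M, hSM⟩ hu1]

lemma bddAtBot_of_mem_globBdd {h : ℝ → ℝ → ℝ} {F : MaxSolFamily h} {s x : ℝ}
    (hx : (s, x) ∈ GlobBdd F) : BddAtBot F s x :=
  hx.2.imp fun _ hC => Eventually.of_forall fun t => ⟨hx.1 t, hC t⟩

lemma bddAtTop_of_mem_globBdd {h : ℝ → ℝ → ℝ} {F : MaxSolFamily h} {s x : ℝ}
    (hx : (s, x) ∈ GlobBdd F) : BddAtTop F s x :=
  hx.2.imp fun _ hC => Eventually.of_forall fun t => ⟨hx.1 t, hC t⟩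

/-- Ordered solutions for different parameters are strictly ordered. -/
lemma lt_of_ordered_solutions {q p f g : ℝ → ℝ} {l₁ l₂ : ℝ} (hl : l₁ ≠ l₂)
    (hf : ∀ t, HasDerivAt f (quadF q (fun t => p t + l₁) t (f t)) t)
    (hg : ∀ t, HasDerivAt g (quadF q (fun t => p t + l₂) t (g t)) t)
    (hle : ∀ t, f t ≤ g t) (t : ℝ) : f t < g t := by
  refine lt_of_le_of_ne (hle t) fun h => hl ?_
  have hmin : IsLocalMin (fun τ => g τ - f τ) t :=
    Eventually.of_forall fun τ => by linarith [hle τ]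
  have := hmin.hasDerivAt_eq_zero ((hg t).sub (hf t))
  simp only [quadF, h] at this
  linarith

theorem stmt12 (q p : ℝ → ℝ)
    (hqb : ∃ C, ∀ t, |q t| ≤ C) (hqu : UniformContinuous q)
    (hpb : ∃ C, ∀ t, |p t| ≤ C) (hpu : UniformContinuous p)
    (F : ∀ lam : ℝ, MaxSolFamily (quadF q (fun t => p t + lam)))
    (lamstar : ℝ)
    (hstar : ∀ lam : ℝ, (∃ b : ℝ → ℝ, IsBddSol q (fun t => p t + lam) b) ↔ lamstar ≤ lam) :
    -- monotonicity of the bounded-solution sets and of a_λ, r_λ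
    (∀ lam₁ lam₂ : ℝ, lamstar ≤ lam₁ → lam₁ < lam₂ →
      GlobBdd (F lam₁) ⊂ GlobBdd (F lam₂) ∧
      ∀ a₁ r₁ a₂ r₂ : ℝ → ℝ,
        CharA (F lam₁) a₁ → CharR (F lam₁) r₁ →
        CharA (F lam₂) a₂ → CharR (F lam₂) r₂ →
        ∀ t : ℝ, r₂ t < r₁ t ∧ r₁ t ≤ a₁ t ∧ a₁ t < a₂ t) ∧
    -- a_λ → ∞ and r_λ → −∞ uniformly as λ → ∞
    (∀ C : ℝ, ∃ lam₀ : ℝ, ∀ lam : ℝ, lam₀ ≤ lam →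
      ∀ a r : ℝ → ℝ, CharA (F lam) a → CharR (F lam) r →
        ∀ t : ℝ, C ≤ a t ∧ r t ≤ -C) := by
  obtain ⟨Q, hQ⟩ := hqb
  obtain ⟨R, hR⟩ := hpb
  have hqc := hqu.continuous
  have hpc := hpu.continuous
  refine ⟨fun l₁ l₂ hl₁ hl => ⟨globBdd_ssubset hqc hpc hQ hR hl _ _ ((hstar l₁).2 hl₁), ?_⟩, ?_⟩
  · intro a₁ r₁ a₂ r₂ ha₁ hr₁ ha₂ hr₂ t
    have hsub := globBdd_subset hqc hpc hQ hR hl (F l₁) (F l₂)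
    have ha : ∀ s, (s, a₁ s) ∈ GlobBdd (F l₁) := IsBddSol.mem_globBdd ⟨ha₁.1, ha₁.2.1⟩ _
    have hr : ∀ s, (s, r₁ s) ∈ GlobBdd (F l₁) := IsBddSol.mem_globBdd ⟨hr₁.1, hr₁.2.1⟩ _
    exact ⟨lt_of_ordered_solutions hl.ne' hr₂.1 hr₁.1
        (fun s => (hr₂.2.2 s _).1 (bddAtTop_of_mem_globBdd (hsub (hr s)))) t,
      (ha₁.2.2 t _).1 (bddAtBot_of_mem_globBdd (hr t)),
      lt_of_ordered_solutions hl.ne ha₁.1 ha₂.1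
        (fun s => (ha₂.2.2 s _).1 (bddAtBot_of_mem_globBdd (hsub (ha s)))) t⟩
  · intro C
    refine ⟨C ^ 2 + Q * |C| + R + 1, fun lam hlam a r ha hr t => ?_⟩
    have hP : ∀ t, |p t + lam| ≤ R + |lam| := fun t =>
      (abs_add_le _ _).trans (add_le_add (hR t) le_rfl)
    have hsubsol : ∀ c : ℝ, |c| ≤ |C| → ∀ t, 0 < quadF q (fun t => p t + lam) t c := by
      intro c hc t
      have h1 := (abs_le.1 (abs_quadF_le (hQ t) (hR t) hc)).1
      rw [sq_abs] at h1
      simp only [quadF] at h1 ⊢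
      linarith
    constructor
    · refine (ha.2.2 t C).1 ⟨max C (max (-C) (Q + (R + |lam|) + 1)), ?_⟩
      filter_upwards [eventually_le_atBot t] with τ hτ
      obtain ⟨h1, h2, h3⟩ := backward_of_subsolution hqc (by fun_prop) hQ hP (F lam)
        (fun t => hasDerivAt_const t C) (hsubsol C le_rfl) (fun _ => le_rfl) le_rfl hτ
      exact ⟨h1, by grind⟩
    · refine (hr.2.2 t (-C)).1 ⟨max C (max (-C) (Q + (R + |lam|) + 1)), ?_⟩
      filter_upwards [eventually_ge_atTop t] with τ hτ
      obtain ⟨h1, h2, h3⟩ := forward_of_subsolution hqc (by fun_prop) hQ hP (F lam)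
        (fun t => hasDerivAt_const t (-C)) (hsubsol (-C) (abs_neg C).le) (fun _ => le_rfl)
        le_rfl hτ
      exact ⟨h1, by grind⟩
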